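/- (Property 4.) Define the extended LIP-top-hat R_b(f)(x) = f(x) ⊟ γ_b(f)(x) (note γ_b(f)(x) < M so this is defined). Then for every constant c < M, R_b(f ⊞ c) = R_b(f), where (f ⊞ c)(y) = f(y) ⊞ c pointwise; i.e., the extended LIP-top-hat is insensitive to the LIP-addition of any constant to f. -/

import Mathlib

/-- LIP-addition: a ⊞ b = a + b - a·b/M. -/
noncomputable def lipAdd (M a b : ℝ) : ℝ := a + b - a * b / M

/-- LIP-difference (defined when b < M): a ⊟ b = M·(a - b)/(M - b). -/
noncomputable def lipSub (M a b : ℝ) : ℝ := M * (a - b) / (M - b)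

/-- LIP-erosion of f by a structuring function a with support Da:
ε_a(f)(x) = min_{h ∈ Da} ( f(x+h) ⊟ a(h) ). -/
noncomputable def lipErosion (M : ℝ) {G : Type*} [AddCommGroup G]
    (Da : Finset G) (hne : Da.Nonempty) (a f : G → ℝ) (x : G) : ℝ :=
  Da.inf' hne fun h => lipSub M (f (x + h)) (a h)

/-- LIP-dilation of f by a structuring function a with support Da:
δ_a(f)(x) = max_{h ∈ Da} ( f(x−h) ⊞ a(h) ). -/
noncomputable def lipDilation (M : ℝ) {G : Type*} [AddCommGroup G]
    (Da : Finset G) (hne : Da.Nonempty) (a f : G → ℝ) (x : G) : ℝ :=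
  Da.sup' hne fun h => lipAdd M (f (x - h)) (a h)

/-- LIP-opening: γ_b(f) = δ_b(ε_b(f)). -/
noncomputable def lipOpening (M : ℝ) {G : Type*} [AddCommGroup G]
    (Db : Finset G) (hne : Db.Nonempty) (b f : G → ℝ) : G → ℝ :=
  lipDilation M Db hne b (lipErosion M Db hne b f)

theorem lipAdd_const_monotone {M c : ℝ} (hM : 0 < M) (hc : c < M) :
    Monotone fun x => lipAdd M x c := by
  intro x y hxy
  have h : 0 ≤ (y - x) * ((M - c) / M) :=
    mul_nonneg (sub_nonneg.2 hxy) (div_nonneg (sub_nonneg.2 hc.le) hM.le)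
  have e : lipAdd M y c - lipAdd M x c = (y - x) * ((M - c) / M) := by
    unfold lipAdd
    field_simp
    ring
  exact sub_nonneg.1 (e ▸ h)

theorem lipAdd_right_comm {M : ℝ} (x y c : ℝ) :
    lipAdd M (lipAdd M x c) y = lipAdd M (lipAdd M x y) c := by
  unfold lipAdd
  ring

theorem lipSub_lipAdd_left {M y : ℝ} (hM : M ≠ 0) (hy : y < M) (x c : ℝ) :
    lipSub M (lipAdd M x c) y = lipAdd M (lipSub M x y) c := by
  have hy' : M - y ≠ 0 := (sub_pos.2 hy).ne'
  unfold lipSub lipAdd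
  field_simp
  ring

theorem lipSub_lipAdd_lipAdd {M c : ℝ} (hM : M ≠ 0) (hc : c ≠ M) (x y : ℝ) :
    lipSub M (lipAdd M x c) (lipAdd M y c) = lipSub M x y := by
  have hk : (M - c) / M ≠ 0 := div_ne_zero (sub_ne_zero.2 hc.symm) hM
  have hnum : M * (lipAdd M x c - lipAdd M y c) = M * (x - y) * ((M - c) / M) := by
    unfold lipAdd
    field_simp
    ring
  have hden : M - lipAdd M y c = (M - y) * ((M - c) / M) := by
    unfold lipAdd
    field_simp
    ring
  rw [lipSub, hnum, hden, mul_div_mul_right _ _ hk, lipSub]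

theorem lipErosion_lipAdd_const {M c : ℝ} (hM : 0 < M) (hc : c < M)
    {G : Type*} [AddCommGroup G] (Da : Finset G) (hne : Da.Nonempty) (a f : G → ℝ)
    (ha : ∀ h ∈ Da, a h < M) :
    lipErosion M Da hne a (fun y => lipAdd M (f y) c) =
      fun x => lipAdd M (lipErosion M Da hne a f x) c := by
  funext x
  unfold lipErosion
  rw [Finset.apply_inf'_eq_inf'_comp hne (fun t => lipAdd M t c)
    (lipAdd_const_monotone hM hc).map_inf]
  exact Finset.inf'_congr hne rfl fun h hh => lipSub_lipAdd_left hM.ne' (ha h hh) _ _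

theorem lipDilation_lipAdd_const {M c : ℝ} (hM : 0 < M) (hc : c < M)
    {G : Type*} [AddCommGroup G] (Da : Finset G) (hne : Da.Nonempty) (a f : G → ℝ) :
    lipDilation M Da hne a (fun y => lipAdd M (f y) c) =
      fun x => lipAdd M (lipDilation M Da hne a f x) c := by
  funext x
  unfold lipDilation
  rw [Finset.apply_sup'_eq_sup'_comp hne (fun t => lipAdd M t c)
    (lipAdd_const_monotone hM hc).map_sup]
  exact Finset.sup'_congr hne rfl fun h _ => lipAdd_right_comm _ _ _

theorem lipOpening_lipAdd_const {M c : ℝ} (hM : 0 < M) (hc : c < M)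
    {G : Type*} [AddCommGroup G] (Db : Finset G) (hne : Db.Nonempty) (b f : G → ℝ)
    (hb : ∀ h ∈ Db, b h < M) :
    lipOpening M Db hne b (fun y => lipAdd M (f y) c) =
      fun x => lipAdd M (lipOpening M Db hne b f x) c := by
  unfold lipOpening
  rw [lipErosion_lipAdd_const hM hc Db hne b f hb, lipDilation_lipAdd_const hM hc]

/-- Property 4: the extended LIP-top-hat
R_b(f)(x) = f(x) ⊟ γ_b(f)(x) is insensitive to the LIP-addition of any
constant c < M to the image f. -/
theorem lipTopHat_lipAdd_const_invariant (M : ℝ) (hM : 0 < M)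
    {G : Type*} [AddCommGroup G]
    (Db : Finset G) (hne : Db.Nonempty) (b : G → ℝ) (hb : ∀ h ∈ Db, b h < M)
    (f : G → ℝ) (hf : ∀ x, f x < M) (c : ℝ) (hc : c < M) :
    let Rb : (G → ℝ) → G → ℝ := fun g x =>
      lipSub M (g x) (lipOpening M Db hne b g x)
    Rb (fun y => lipAdd M (f y) c) = Rb f := by
  intro Rb
  funext x
  simp only [Rb, lipOpening_lipAdd_const hM hc Db hne b f hb]
  exact lipSub_lipAdd_lipAdd hM.ne' hc.ne _ _
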